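/- Let a be a real m×m matrix satisfying Σ_k ε(k)·a(k,i)·a(k,j) = ε(i)·δ_{ij} for all i, j ∈ Fin m, and let b be a real n×n matrix satisfying Σ_γ ε'(γ)·b(γ,α)·b(γ,β) = ε'(α)·δ_{αβ} for all α, β ∈ Fin n. Let h : Fin n → Fin m → Fin m → ℝ satisfy h(α,i,j) = h(α,j,i) for all α, i, j, and define h'(α,i,j) = Σ_{β,k,l} b(α,β)·a(k,i)·a(l,j)·h(β,k,l). Then Q₂(h') = Q₂(h). -/

import Mathlib

/-- Sign sequence ε : Fin m → ℝ of index p. -/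
def eps (m p : ℕ) (i : Fin m) : ℝ := if (i : ℕ) < p then -1 else 1

/-- The invariant polynomial Q₂(h) = Σ_α ε'(α)·(Σ_i ε(i)·h(α,i,i))². -/
def Q₂ (m n p q : ℕ) (h : Fin n → Fin m → Fin m → ℝ) : ℝ :=
  ∑ α : Fin n, eps n q α * (∑ i : Fin m, eps m p i * h α i i) ^ 2

lemma eps_mul_self' (m p : ℕ) (i : Fin m) : eps m p i * eps m p i = 1 := by
  unfold eps; split_ifs <;> norm_num

/-- The dual orthogonality relation: rows instead of columns. -/
lemma dual_rel (m p : ℕ) (a : Matrix (Fin m) (Fin m) ℝ)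
    (ha : ∀ i j : Fin m,
      ∑ k : Fin m, eps m p k * a k i * a k j = eps m p i * (if i = j then 1 else 0))
    (k l : Fin m) :
    ∑ i : Fin m, eps m p i * a k i * a l i = eps m p k * (if k = l then 1 else 0) := by
  let c : Matrix (Fin m) (Fin m) ℝ := fun i k => eps m p i * a k i * eps m p k
  have h1 : c * a = 1 := by
    ext i j
    rw [Matrix.mul_apply, Matrix.one_apply]
    calc ∑ k, c i k * a k j = eps m p i * ∑ k, eps m p k * a k i * a k j := by
          rw [Finset.mul_sum]
          refine Finset.sum_congr rfl fun k _ => ?_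
          simp only [c]; ring
      _ = _ := by rw [ha, ← mul_assoc, eps_mul_self', one_mul]
  have h2 : a * c = 1 := mul_eq_one_comm.mp h1
  have h3 := congrFun (congrFun h2 k) l
  rw [Matrix.mul_apply, Matrix.one_apply] at h3
  have h4 : ∑ i, a k i * c i l = (∑ i, eps m p i * a k i * a l i) * eps m p l := by
    rw [Finset.sum_mul]
    refine Finset.sum_congr rfl fun i _ => ?_
    simp only [c]; ring
  rw [h4] at h3
  have h5 := congrArg (· * eps m p l) h3
  simp only [mul_assoc, eps_mul_self', mul_one] at h5
  simp only [mul_assoc]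
  rw [h5]
  split_ifs with hkl
  · subst hkl; ring
  · ring

/-- Q₂ is invariant under the action of O(p, m−p) × O(q, n−q). -/
theorem stmt_14 (m n p q : ℕ) (hp : p ≤ m) (hq : q ≤ n)
    (a : Matrix (Fin m) (Fin m) ℝ)
    (ha : ∀ i j : Fin m,
      ∑ k : Fin m, eps m p k * a k i * a k j = eps m p i * (if i = j then 1 else 0))
    (b : Matrix (Fin n) (Fin n) ℝ)
    (hb : ∀ α β : Fin n,
      ∑ γ : Fin n, eps n q γ * b γ α * b γ β = eps n q α * (if α = β then 1 else 0))
    (h : Fin n → Fin m → Fin m → ℝ)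
    (hsym : ∀ (α : Fin n) (i j : Fin m), h α i j = h α j i) :
    Q₂ m n p q (fun α i j =>
      ∑ β : Fin n, ∑ k : Fin m, ∑ l : Fin m, b α β * a k i * a l j * h β k l)
      = Q₂ m n p q h := by
  have key : ∀ α, ∑ i : Fin m, eps m p i *
      (∑ β : Fin n, ∑ k : Fin m, ∑ l : Fin m, b α β * a k i * a l i * h β k l)
      = ∑ β, b α β * ∑ k, eps m p k * h β k k := by
    intro α
    simp only [Finset.mul_sum]
    rw [Finset.sum_comm]
    refine Finset.sum_congr rfl fun β _ => ?_
    rw [Finset.sum_comm]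
    refine Finset.sum_congr rfl fun k _ => ?_
    rw [Finset.sum_comm]
    calc _ = ∑ l, (b α β * h β k l) * ∑ i, eps m p i * a k i * a l i := by
          refine Finset.sum_congr rfl fun l _ => ?_
          rw [Finset.mul_sum]
          refine Finset.sum_congr rfl fun i _ => ?_
          ring
      _ = _ := by
          simp only [dual_rel m p a ha, mul_ite, mul_one, mul_zero, Finset.sum_ite_eq,
            Finset.mem_univ, if_true]
          ring
  unfold Q₂
  simp only [key]
  set t : Fin n → ℝ := fun β => ∑ k, eps m p k * h β k k with ht
  change ∑ α, eps n q α * (∑ β, b α β * t β) ^ 2 = ∑ α, eps n q α * t α ^ 2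
  simp only [sq, Finset.sum_mul_sum]
  simp only [Finset.mul_sum]
  rw [Finset.sum_comm]
  refine Finset.sum_congr rfl fun β _ => ?_
  rw [Finset.sum_comm]
  calc _ = ∑ γ, (t β * t γ) * ∑ α, eps n q α * b α β * b α γ := by
        refine Finset.sum_congr rfl fun γ _ => ?_
        rw [Finset.mul_sum]
        refine Finset.sum_congr rfl fun α _ => ?_
        ring
    _ = _ := by
        simp only [hb, mul_ite, mul_one, mul_zero, Finset.sum_ite_eq,
          Finset.mem_univ, if_true]
        ring
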